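/- Let n ≥ 3 and a > 1. Consider the function ψ(r, s) = −√(1 − (r−a)² − s²) on the region 1 − (r−a)² − s² > 0, r > 0. At a point with coordinates (0,…,0, r, s) (so that x^{n−1} = r, x^n = s), the shape operator of the graph x^{n+1} = ψ in ℝ^{n+1} (computed with respect to the downward graph and induced metric g_{αβ} = δ_{αβ} + ψ_α ψ_β) is the block diagonal matrix diag((1 − a/r)·I_{n−2}, I₂). Consequently, for 2 ≤ k ≤ n, σ_k(A) = binom(n−2,k)t^k + 2binom(n−2,k−1)t^{k−1} + binom(n−2,k−2)t^{k−2} with t = 1 − a/r, and σ₁(A) = (n−2)t + 2. -/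

import Mathlib

/-- The Euclidean norm of the part of `x` with coordinates in `T`. -/
noncomputable def partialNorm {ι : Type*} (T : Finset ι) (x : ι → ℝ) : ℝ :=
  Real.sqrt (∑ i ∈ T, x i ^ 2)

/-- The square of the height of the rotated sphere `(r - a)² + x_z² + h² = 1` over `x`. -/
noncomputable def torusHeightSq {ι : Type*} (T : Finset ι) (z : ι) (a : ℝ) (x : ι → ℝ) : ℝ :=
  1 - (partialNorm T x - a) ^ 2 - x z ^ 2

/-- Up to the factor `√(torusHeightSq)`, the partial derivatives of `-√(torusHeightSq)`. -/
noncomputable def torusSlope {ι : Type*} [DecidableEq ι] (T : Finset ι) (a : ℝ) (α : ι)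
    (x : ι → ℝ) : ℝ :=
  x α * (if α ∈ T then 1 - a / partialNorm T x else 1)

lemma continuous_partialNorm {ι : Type*} (T : Finset ι) : Continuous (partialNorm T) := by
  unfold partialNorm
  fun_prop

lemma continuous_torusHeightSq {ι : Type*} (T : Finset ι) (z : ι) (a : ℝ) :
    Continuous (torusHeightSq T z a) := by
  have := continuous_partialNorm T
  unfold torusHeightSq
  fun_prop

section Calculus

variable {ι : Type*} [Fintype ι] {T : Finset ι} {z : ι} {a : ℝ} {x : ι → ℝ}

lemma hasFDerivAt_partialNorm (hx : partialNorm T x ≠ 0) :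
    HasFDerivAt (partialNorm T)
      (∑ i ∈ T, (x i / partialNorm T x) • ContinuousLinearMap.proj (R := ℝ) (φ := fun _ => ℝ) i)
      x := by
  have hq : HasFDerivAt (fun y : ι → ℝ => ∑ i ∈ T, y i ^ 2)
      (∑ i ∈ T, (2 * x i) • ContinuousLinearMap.proj (R := ℝ) (φ := fun _ => ℝ) i) x := by
    refine HasFDerivAt.fun_sum fun i _ => ?_
    have hi : HasFDerivAt (fun y : ι → ℝ => y i) _ x := hasFDerivAt_apply (𝕜 := ℝ) i x
    simpa using hi.pow 2
  have hne : ∑ i ∈ T, x i ^ 2 ≠ 0 := fun h => hx (by simp [partialNorm, h])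
  refine (hq.sqrt hne).congr_fderiv ?_
  rw [Finset.smul_sum]
  refine Finset.sum_congr rfl fun i _ => ?_
  rw [smul_smul]
  congr 1
  change 1 / (2 * partialNorm T x) * (2 * x i) = _
  field_simp

lemma hasFDerivAt_torusHeightSq (hx : partialNorm T x ≠ 0) :
    HasFDerivAt (torusHeightSq T z a)
      (-(2 * (partialNorm T x - a)) • fderiv ℝ (partialNorm T) x -
        (2 * x z) • ContinuousLinearMap.proj (R := ℝ) (φ := fun _ => ℝ) z) x := by
  have hρ := (hasFDerivAt_partialNorm hx).differentiableAt.hasFDerivAt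
  refine ((((hρ.sub_const a).pow 2).const_sub 1).sub
    ((hasFDerivAt_apply z x).pow 2)).congr_fderiv ?_
  ext v
  simp

variable [DecidableEq ι]

lemma fderiv_partialNorm_single (hx : partialNorm T x ≠ 0) (β : ι) :
    fderiv ℝ (partialNorm T) x (Pi.single β 1) =
      if β ∈ T then x β / partialNorm T x else 0 := by
  rw [(hasFDerivAt_partialNorm hx).fderiv]
  simp [Pi.single_apply]

lemma fderiv_torusHeightSq_single (hT : ∀ i, i ∈ T ↔ i ≠ z) (hx : partialNorm T x ≠ 0) (β : ι) :
    fderiv ℝ (torusHeightSq T z a) x (Pi.single β 1) = -2 * torusSlope T a β x := by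
  rw [(hasFDerivAt_torusHeightSq hx).fderiv]
  by_cases h : β = z
  · subst h
    simp [fderiv_partialNorm_single hx, torusSlope, hT]
  · simp [fderiv_partialNorm_single hx, torusSlope, hT, h, Ne.symm h]
    field_simp

lemma fderiv_neg_sqrt_torusHeightSq_single (hT : ∀ i, i ∈ T ↔ i ≠ z)
    (hx : partialNorm T x ≠ 0) (hG : 0 < torusHeightSq T z a x) (β : ι) :
    fderiv ℝ (fun y => -Real.sqrt (torusHeightSq T z a y)) x (Pi.single β 1) =
      torusSlope T a β x / Real.sqrt (torusHeightSq T z a x) := by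
  have h := (hasFDerivAt_torusHeightSq (z := z) (a := a) hx).differentiableAt.hasFDerivAt
  rw [((h.sqrt hG.ne').fun_neg).fderiv]
  simp only [neg_apply, smul_apply, smul_eq_mul,
    fderiv_torusHeightSq_single hT hx]
  have := (Real.sqrt_pos.2 hG).ne'
  field_simp

lemma differentiableAt_and_fderiv_torusSlope_single (hx : partialNorm T x ≠ 0) (α β : ι) :
    DifferentiableAt ℝ (torusSlope T a α) x ∧
    fderiv ℝ (torusSlope T a α) x (Pi.single β 1) =
      if α ∈ T then (if α = β then 1 - a / partialNorm T x else 0) +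
          (if β ∈ T then a * x α * x β / partialNorm T x ^ 3 else 0)
        else if α = β then 1 else 0 := by
  by_cases hα : α ∈ T
  · have hρ := (hasFDerivAt_partialNorm hx).differentiableAt.hasFDerivAt
    have h := (hasFDerivAt_apply (𝕜 := ℝ) α x).mul
      (((hasDerivAt_inv hx).comp_hasFDerivAt x hρ).const_mul a |>.const_sub 1)
    have h' : HasFDerivAt (torusSlope T a α) _ x := h.congr_of_eventuallyEq
      (.of_forall fun y => by simp [torusSlope, hα, div_eq_mul_inv])
    refine ⟨h'.differentiableAt, ?_⟩
    rw [h'.fderiv]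
    by_cases hβ : β ∈ T <;> by_cases hαβ : α = β <;>
      simp_all [fderiv_partialNorm_single hx] <;> field_simp <;> ring
  · have h' : HasFDerivAt (torusSlope T a α) _ x :=
      (hasFDerivAt_apply (𝕜 := ℝ) α x).congr_of_eventuallyEq
        (.of_forall fun y => by simp [torusSlope, hα])
    refine ⟨h'.differentiableAt, ?_⟩
    rw [h'.fderiv]
    simp [hα, Pi.single_apply]

lemma fderiv_fderiv_neg_sqrt_torusHeightSq_single (hT : ∀ i, i ∈ T ↔ i ≠ z)
    (hx : partialNorm T x ≠ 0) (hG : 0 < torusHeightSq T z a x) (α β : ι) :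
    fderiv ℝ (fun y => fderiv ℝ (fun y => -Real.sqrt (torusHeightSq T z a y)) y (Pi.single α 1))
        x (Pi.single β 1) =
      (fderiv ℝ (torusSlope T a α) x (Pi.single β 1) +
        torusSlope T a α x * torusSlope T a β x / torusHeightSq T z a x) /
          Real.sqrt (torusHeightSq T z a x) := by
  have hloc : (fun y => fderiv ℝ (fun y => -Real.sqrt (torusHeightSq T z a y)) y
      (Pi.single α 1)) =ᶠ[nhds x]
      fun y => torusSlope T a α y * (Real.sqrt (torusHeightSq T z a y))⁻¹ := by
    filter_upwards [(continuous_partialNorm T).continuousAt.eventually_ne hx,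
      (continuous_torusHeightSq T z a).continuousAt.eventually (lt_mem_nhds hG)] with y h1 h2
    rw [fderiv_neg_sqrt_torusHeightSq_single hT h1 h2, div_eq_mul_inv]
  have h := (hasFDerivAt_torusHeightSq (z := z) (a := a) hx).differentiableAt.hasFDerivAt
  have hw := Real.sqrt_pos.2 hG
  have hN := (differentiableAt_and_fderiv_torusSlope_single (a := a) hx α β).1.hasFDerivAt
  have hF := hN.fun_mul ((hasDerivAt_inv hw.ne').comp_hasFDerivAt x (h.sqrt hG.ne'))
  simp only [Function.comp_apply] at hF
  rw [hloc.fderiv_eq, hF.fderiv]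
  simp only [add_apply, smul_apply, smul_eq_mul,
    fderiv_torusHeightSq_single hT hx]
  have hsq := Real.sq_sqrt hG.le
  generalize Real.sqrt (torusHeightSq T z a x) = w at *
  rw [← hsq]
  field_simp
  ring

end Calculus

lemma Multiset.esymm_cons_succ {R : Type*} [CommSemiring R] (c : R) (s : Multiset R) (k : ℕ) :
    (c ::ₘ s).esymm (k + 1) = s.esymm (k + 1) + c * s.esymm k := by
  simp [Multiset.esymm, Multiset.powersetCard_cons, Multiset.sum_map_mul_left]

lemma Multiset.esymm_replicate {R : Type*} [CommSemiring R] (m : ℕ) (c : R) (k : ℕ) :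
    (Multiset.replicate m c).esymm k = (m.choose k : R) * c ^ k := by
  induction m generalizing k with
  | zero => cases k <;> simp [Multiset.esymm, Multiset.powersetCard_zero_right]
  | succ m ih =>
    cases k with
    | zero => simp [Multiset.esymm]
    | succ k =>
      rw [Multiset.replicate_succ, Multiset.esymm_cons_succ, ih, ih, Nat.choose_succ_succ]
      push_cast
      ring

lemma Matrix.diagonal_add_vecMulVec_mul_inv {ι : Type*} [Fintype ι] [DecidableEq ι]
    (d v : ι → ℝ) (hdv : ∀ i, d i * v i = v i) :
    (Matrix.diagonal d + Matrix.vecMulVec v v) * (1 + Matrix.vecMulVec v v)⁻¹ =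
      Matrix.diagonal d := by
  have hg : (1 + Matrix.vecMulVec v v : Matrix ι ι ℝ).PosDef :=
    Matrix.PosDef.one.add_posSemidef (by simpa using Matrix.posSemidef_vecMulVec_self_star v)
  have hfac : Matrix.diagonal d + Matrix.vecMulVec v v =
      Matrix.diagonal d * (1 + Matrix.vecMulVec v v) := by
    rw [mul_add, mul_one]
    congr 1
    ext i j
    rw [Matrix.diagonal_mul, Matrix.vecMulVec_apply, ← mul_assoc, hdv]
  rw [hfac, Matrix.mul_nonsing_inv_cancel_right _ _ ((Matrix.isUnit_iff_isUnit_det _).1 hg.isUnit)]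

lemma Fin.map_univ_val_ite_lt {R : Type*} (m : ℕ) (b c : R) :
    (Finset.univ : Finset (Fin (m + 2))).val.map (fun i => if i.val < m then b else c) =
      c ::ₘ c ::ₘ Multiset.replicate m b := by
  rw [Fin.univ_castSuccEmb, Finset.cons_val, Multiset.map_cons, Finset.map_val, Multiset.map_map,
    Fin.univ_castSuccEmb, Finset.cons_val, Multiset.map_cons, Finset.map_val, Multiset.map_map]
  simp [Function.comp_def]


/-- Example 4.2, curvature computation: for the graph `x^{n+1} = ψ` of
`ψ(x) = −√(1 − (r−a)² − (xⁿ)²)` (with `r = √((x¹)²+⋯+(x^{n−1})²)`), at a point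
`p = (0,…,0,r,s)`, the shape operator (second fundamental form
`A_{αβ} = ψ_{αβ}/√(1+|Dψ|²)` composed with the inverse of the induced metric
`g_{αβ} = δ_{αβ} + ψ_αψ_β`) is `diag((1−a/r)·I_{n−2}, I₂)`. Consequently, with
`t = 1 − a/r`, the `k`-th mean curvature is
`σ_k = C(n−2,k)t^k + 2C(n−2,k−1)t^{k−1} + C(n−2,k−2)t^{k−2}` for `2 ≤ k ≤ n`,
and `σ₁ = (n−2)t + 2`. -/
theorem stmt14 (n : ℕ) (hn : 3 ≤ n) (a : ℝ) (ha : 1 < a) (r s : ℝ) (hr : 0 < r)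
    (hdom : 0 < 1 - (r - a) ^ 2 - s ^ 2) :
    let ψ : (Fin n → ℝ) → ℝ := fun x =>
      -Real.sqrt (1 - (Real.sqrt (∑ i ∈ Finset.univ.filter
          (fun i : Fin n => i.val < n - 1), (x i) ^ 2) - a) ^ 2
        - (x ⟨n - 1, by omega⟩) ^ 2)
    let p : Fin n → ℝ := fun i =>
      if i.val = n - 2 then r else if i.val = n - 1 then s else 0
    let F : Fin n → (Fin n → ℝ) → ℝ := fun α x => fderiv ℝ ψ x (Pi.single α 1)
    let S : Fin n → Fin n → ℝ := fun α β => fderiv ℝ (F α) p (Pi.single β 1)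
    let g : Matrix (Fin n) (Fin n) ℝ := fun α β =>
      (if α = β then 1 else 0) + F α p * F β p
    let A : Matrix (Fin n) (Fin n) ℝ := fun α β =>
      S α β / Real.sqrt (1 + ∑ γ, (F γ p) ^ 2)
    let shape : Matrix (Fin n) (Fin n) ℝ := A * g⁻¹
    let d : Fin n → ℝ := fun α => if α.val < n - 2 then 1 - a / r else 1
    let t : ℝ := 1 - a / r
    shape = Matrix.diagonal d ∧
    (∀ k : ℕ, 2 ≤ k → k ≤ n →
        (Finset.univ.val.map d).esymm k =
          (Nat.choose (n - 2) k : ℝ) * t ^ k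
            + 2 * (Nat.choose (n - 2) (k - 1) : ℝ) * t ^ (k - 1)
            + (Nat.choose (n - 2) (k - 2) : ℝ) * t ^ (k - 2)) ∧
    shape.trace = ((n : ℝ) - 2) * t + 2 := by
  intro ψ p F S g A shape d t
  obtain ⟨m, rfl⟩ : ∃ m, n = m + 2 := ⟨n - 2, by omega⟩
  set T : Finset (Fin (m + 2)) := Finset.univ.filter (fun i => i.val < m + 2 - 1) with hTdef
  set z : Fin (m + 2) := ⟨m + 2 - 1, by omega⟩ with hz
  have hT : ∀ i, i ∈ T ↔ i ≠ z := fun i => by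
    simp only [hTdef, hz, Finset.mem_filter, Finset.mem_univ, true_and, ne_eq, Fin.ext_iff]
    omega
  have hpz : p z = s := by simp [p, hz]
  have hρ : partialNorm T p = r := by
    rw [partialNorm, Finset.sum_eq_single (⟨m, by omega⟩ : Fin (m + 2))]
    · simp [p, Real.sqrt_sq hr.le]
    · intro i hi hne
      have h1 : i.val < m + 2 - 1 := by simpa [hTdef] using hi
      have h2 : i.val ≠ m := fun h => hne (Fin.ext h)
      have h3 : i.val ≠ m + 1 := by omega
      simp [p, h2, h3]
    · simp [hTdef]
  have hρ0 : partialNorm T p ≠ 0 := hρ ▸ hr.ne'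
  have hG : torusHeightSq T z a p = 1 - (r - a) ^ 2 - s ^ 2 := by
    rw [torusHeightSq, hρ, hpz]
  have hG0 : 0 < torusHeightSq T z a p := hG ▸ hdom
  set w := Real.sqrt (torusHeightSq T z a p) with hw
  have hw0 : 0 < w := Real.sqrt_pos.2 hG0
  have hww : w ^ 2 = torusHeightSq T z a p := Real.sq_sqrt hG0.le
  have hF : ∀ α, F α p = torusSlope T a α p / w :=
    fun α => fderiv_neg_sqrt_torusHeightSq_single hT hρ0 hG0 α
  have hN : ∀ α, torusSlope T a α p =
      if α.val = m then r - a else if α.val = m + 1 then s else 0 := fun α => by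
    have hα := α.isLt
    rw [torusSlope, hρ]
    by_cases h1 : α.val = m
    · simp [p, hTdef, h1]
      field_simp
    · by_cases h2 : α.val = m + 1 <;> simp [p, hTdef, h1, h2]
  have hD : ∀ α β, fderiv ℝ (torusSlope T a α) p (Pi.single β 1) = Matrix.diagonal d α β := by
    intro α β
    rw [(differentiableAt_and_fderiv_torusSlope_single hρ0 α β).2, hρ, Matrix.diagonal_apply]
    have hα := α.isLt
    have hβ := β.isLt
    by_cases hαβ : α = β
    · subst hαβ
      rcases lt_trichotomy α.val m with h | h | h
      · have h3 : α.val ≠ m + 1 := by omega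
        simp [d, p, hTdef, h, h.ne, h.le, h3]
      · simp [d, p, hTdef, h]
        field_simp
        ring
      · have h2 : α.val = m + 1 := by omega
        simp [d, hTdef, h2]
    · have h : α.val ≠ β.val := fun h => hαβ (Fin.ext h)
      simp only [hαβ, if_false, zero_add]
      split_ifs with h1 h2
      · have h1' : α.val < m + 1 := by simpa [hTdef] using h1
        have h2' : β.val < m + 1 := by simpa [hTdef] using h2
        by_cases h3 : α.val = m
        · have h4 : β.val ≠ m := by omega
          have h5 : β.val ≠ m + 1 := by omega
          simp [p, h4, h5]
        · have h5 : α.val ≠ m + 1 := by omega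
          simp [p, h3, h5]
      all_goals rfl
  have hsum : Real.sqrt (1 + ∑ γ, F γ p ^ 2) = w⁻¹ := by
    have h : ∑ γ, F γ p ^ 2 = ((r - a) ^ 2 + s ^ 2) / w ^ 2 := by
      simp_rw [hF, hN]
      rw [Fin.sum_univ_castSucc, Fin.sum_univ_castSucc]
      have h0 : ∀ i : Fin m, i.val ≠ m + 1 := fun i => by omega
      simp [(Fin.is_lt _).ne, h0]
      ring
    rw [h, ← Real.sqrt_sq (inv_nonneg.2 hw0.le)]
    congr 1
    field_simp
    rw [hww, hG]
    ring
  have hA : A = Matrix.diagonal d + Matrix.vecMulVec (F · p) (F · p) := by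
    ext α β
    have hS : S α β = (Matrix.diagonal d α β +
        torusSlope T a α p * torusSlope T a β p / w ^ 2) / w := by
      rw [← hD, hww]
      exact fderiv_fderiv_neg_sqrt_torusHeightSq_single hT hρ0 hG0 α β
    change S α β / Real.sqrt (1 + ∑ γ, F γ p ^ 2) = _
    rw [hsum, hS, Matrix.add_apply, Matrix.vecMulVec_apply, hF, hF]
    field_simp
  have hg : g = 1 + Matrix.vecMulVec (F · p) (F · p) := by
    ext α β
    simp [g, Matrix.one_apply, Matrix.vecMulVec_apply]
  have hshape : shape = Matrix.diagonal d := by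
    simp only [shape, hA, hg]
    refine Matrix.diagonal_add_vecMulVec_mul_inv d _ fun α => ?_
    rw [hF, hN]
    by_cases h : α.val < m
    · have h3 : α.val ≠ m + 1 := by omega
      simp [h.ne, h3]
    · simp [d, h]
  have hd : Finset.univ.val.map d = 1 ::ₘ 1 ::ₘ Multiset.replicate m t :=
    Fin.map_univ_val_ite_lt m t 1
  refine ⟨hshape, fun k hk _ => ?_, ?_⟩
  · obtain ⟨j, rfl⟩ : ∃ j, k = j + 2 := ⟨k - 2, by omega⟩
    rw [hd]
    simp only [Multiset.esymm_cons_succ, Multiset.esymm_replicate, Nat.add_sub_cancel,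
      show j + 2 - 1 = j + 1 from rfl]
    ring
  · rw [hshape, Matrix.trace_diagonal, Finset.sum, hd]
    simp
    ring
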